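/- Let 1 ≤ k ≤ n, let Z_k denote the number of k-dimensional F_2-subspaces E of F_{2^n} with ∑_{u∈E, u≠0} u^{-1} = 0, and let G ∈ F_2[X_1,...,X_k] satisfy Δ·G = Δ_1. Then the number of k-tuples (u_1,...,u_k) ∈ F_{2^n}^k that are linearly independent over F_2 and satisfy G(u_1,...,u_k) = 0 equals Z_k · |GL(k, F_2)|, and the number of k-tuples (v_1,...,v_k) ∈ F_{2^n}^k that are linearly independent over F_2 and satisfy Θ_k(v_1,...,v_k) = 0 also equals Z_k · |GL(k, F_2)|. -/

import Mathlib

open MvPolynomial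

/-- The Moore determinant `Δ(X_1,…,X_k) = det (X_j^{2^{i-1}})_{1 ≤ i,j ≤ k}` over `F₂`. -/
noncomputable def MooreDet (k : ℕ) : MvPolynomial (Fin k) (ZMod 2) :=
  Matrix.det (Matrix.of fun i j : Fin k =>
    (X j : MvPolynomial (Fin k) (ZMod 2)) ^ 2 ^ (i : ℕ))

/-- `Δ₁(X_1,…,X_k)`: the determinant of the `k×k` matrix whose rows consist of
`X_j^{2^0}, X_j^{2^2}, X_j^{2^3}, …, X_j^{2^k}`. -/
noncomputable def MooreDet1 (k : ℕ) : MvPolynomial (Fin k) (ZMod 2) :=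
  Matrix.det (Matrix.of fun i j : Fin k =>
    (X j : MvPolynomial (Fin k) (ZMod 2)) ^ 2 ^ (if (i : ℕ) = 0 then 0 else (i : ℕ) + 1))

open scoped Classical in
/-- `Θ_k = ∑_{λ ∈ Λ_k} m_λ ∈ F₂[X_1,…,X_k]`, where `Λ_k` is the set of partitions of
`2^(k-1)` with at most `k` parts all of which are powers of `2`, and `m_λ` is the
monomial symmetric polynomial associated to `λ` (coefficients reduced mod 2). -/
noncomputable def Theta (k : ℕ) : MvPolynomial (Fin k) (ZMod 2) :=
  ∑ μ ∈ Finset.univ.filter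
      (fun μ : Nat.Partition (2 ^ (k - 1)) =>
        μ.parts.card ≤ k ∧ ∀ i ∈ μ.parts, ∃ j, i = 2 ^ j),
    MvPolynomial.msymm (Fin k) (ZMod 2) μ

/-- The truncated series `1 + ∑_{i ≤ k} (x T)^(2^i)`. -/
noncomputable def binarySeries {K : Type*} [Field K] (k : ℕ) (x : K) : PowerSeries K :=
  1 + ∑ i ∈ Finset.range (k + 1), PowerSeries.C (x ^ 2 ^ i) * PowerSeries.X ^ 2 ^ i

/-- The product of the truncated series attached to the entries of `v`; its coefficients of
degree `2^k - 2^i` are the Dickson invariants of `v`. -/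
noncomputable def dicksonSeries {K : Type*} [Field K] {k : ℕ} (v : Fin k → K) : PowerSeries K :=
  ∏ j, binarySeries k (v j)

/-- The coefficient of `x^(2^i)` in the linearized polynomial with root set the span of `v`. -/
noncomputable def dicksonInvariant {K : Type*} [Field K] {k : ℕ} (v : Fin k → K) (i : ℕ) : K :=
  PowerSeries.coeff (2 ^ k - 2 ^ i) (dicksonSeries v)

theorem digits_two_sum_two_mul (m : ℕ) :
    (Nat.digits 2 (2 * m)).sum = (Nat.digits 2 m).sum := by
  rcases Nat.eq_zero_or_pos m with rfl | hm
  · simp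
  · rw [Nat.digits_def' (by norm_num) (by omega)]
    simp

theorem digits_two_sum_two_mul_add_one (m : ℕ) :
    (Nat.digits 2 (2 * m + 1)).sum = (Nat.digits 2 m).sum + 1 := by
  rw [Nat.digits_def' (by norm_num) (by omega), List.sum_cons,
    show (2 * m + 1) % 2 = 1 by omega, show (2 * m + 1) / 2 = m by omega, add_comm]

theorem digits_two_sum_add_one_le (n : ℕ) :
    (Nat.digits 2 (n + 1)).sum ≤ (Nat.digits 2 n).sum + 1 := by
  induction n using Nat.strong_induction_on with
  | _ n ih =>
    obtain ⟨m, rfl | rfl⟩ := Nat.even_or_odd' n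
    · rw [digits_two_sum_two_mul_add_one, digits_two_sum_two_mul]
    · have := ih m (by omega)
      rw [show 2 * m + 1 + 1 = 2 * (m + 1) by ring, digits_two_sum_two_mul_add_one,
        digits_two_sum_two_mul]
      omega

theorem digits_two_sum_add_two_pow_le (i n : ℕ) :
    (Nat.digits 2 (n + 2 ^ i)).sum ≤ (Nat.digits 2 n).sum + 1 := by
  induction i generalizing n with
  | zero => exact digits_two_sum_add_one_le n
  | succ i ih =>
    obtain ⟨m, rfl | rfl⟩ := Nat.even_or_odd' n
    · rw [show 2 * m + 2 ^ (i + 1) = 2 * (m + 2 ^ i) by ring, digits_two_sum_two_mul,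
        digits_two_sum_two_mul]
      exact ih m
    · rw [show 2 * m + 1 + 2 ^ (i + 1) = 2 * (m + 2 ^ i) + 1 by ring,
        digits_two_sum_two_mul_add_one, digits_two_sum_two_mul_add_one]
      have := ih m
      omega

theorem digits_two_sum_two_pow_sub_one (k : ℕ) : (Nat.digits 2 (2 ^ k - 1)).sum = k := by
  induction k with
  | zero => simp
  | succ k ih =>
    have := Nat.one_le_two_pow (n := k)
    rw [show 2 ^ (k + 1) - 1 = 2 * (2 ^ k - 1) + 1 by omega, digits_two_sum_two_mul_add_one, ih]

section

variable {K : Type*} [Field K] {k : ℕ}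

theorem coeff_mul_binarySeries_sub_one (p : PowerSeries K) (x : K) :
    PowerSeries.coeff (2 ^ k) (p * (binarySeries k x - 1)) =
      ∑ i ∈ Finset.range (k + 1), PowerSeries.coeff (2 ^ k - 2 ^ i) p * x ^ 2 ^ i := by
  rw [binarySeries, add_sub_cancel_left, Finset.mul_sum, map_sum]
  refine Finset.sum_congr rfl fun i hi => ?_
  have : 2 ^ i ≤ 2 ^ k := Nat.pow_le_pow_right (by norm_num) (by simp at hi; omega)
  rw [mul_left_comm, PowerSeries.coeff_C_mul, PowerSeries.coeff_mul_X_pow', if_pos this, mul_comm]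

open scoped Classical in
theorem coeff_binarySeries (x : K) (m : ℕ) (hm : m ≤ 2 ^ k) :
    PowerSeries.coeff m (binarySeries k x) =
      if m = 0 ∨ ∃ i, m = 2 ^ i then x ^ m else 0 := by
  rw [binarySeries, map_add, map_sum, PowerSeries.coeff_one]
  simp only [PowerSeries.coeff_C_mul_X_pow]
  rcases Nat.eq_zero_or_pos m with rfl | hm0
  · simp only [true_or, if_true, pow_zero]
    rw [Finset.sum_eq_zero, add_zero]
    intro i _
    rw [if_neg (by positivity)]
  · rw [if_neg hm0.ne', zero_add]
    by_cases h : ∃ i, m = 2 ^ i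
    · obtain ⟨i, rfl⟩ := h
      rw [if_pos (Or.inr ⟨i, rfl⟩), Finset.sum_eq_single i]
      · simp
      · intro j _ hj
        rw [if_neg fun h => hj (Nat.pow_right_injective le_rfl h).symm]
      · intro hi
        have := (Nat.pow_le_pow_iff_right (a := 2) (by norm_num)).1 hm
        simp at hi
        omega
    · rw [if_neg (by push Not; exact ⟨hm0.ne', by simpa using h⟩)]
      refine Finset.sum_eq_zero fun i _ => if_neg fun hi => h ⟨i, hi⟩

theorem coeff_binarySeries_eq_zero (x : K) (m : ℕ) (hm : m ≠ 0) (h : ∀ i, m ≠ 2 ^ i) :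
    PowerSeries.coeff m (binarySeries k x) = 0 := by
  rw [binarySeries, map_add, map_sum, PowerSeries.coeff_one, if_neg hm, zero_add]
  refine Finset.sum_eq_zero fun i _ => ?_
  rw [PowerSeries.coeff_C_mul_X_pow, if_neg (h i)]

theorem coeff_prod_binarySeries_eq_zero {ι : Type*} (v : ι → K) (s : Finset ι) (m : ℕ)
    (hm : s.card < (Nat.digits 2 m).sum) :
    PowerSeries.coeff m (∏ j ∈ s, binarySeries k (v j)) = 0 := by
  classical
  induction s using Finset.induction_on generalizing m with
  | empty =>
    rw [Finset.prod_empty, PowerSeries.coeff_one, if_neg]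
    rintro rfl
    simp at hm
  | insert a s ha ih =>
    rw [Finset.prod_insert ha, PowerSeries.coeff_mul]
    rw [Finset.card_insert_of_notMem ha] at hm
    refine Finset.sum_eq_zero fun p hp => ?_
    rw [Finset.HasAntidiagonal.mem_antidiagonal] at hp
    by_cases h0 : p.1 = 0
    · rw [ih p.2 (by rw [show p.2 = m by omega]; omega), mul_zero]
    · by_cases h : ∃ i, p.1 = 2 ^ i
      · obtain ⟨i, hi⟩ := h
        have := digits_two_sum_add_two_pow_le i p.2
        rw [← hi, add_comm p.2, hp] at this
        rw [ih p.2 (by omega), mul_zero]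
      · rw [coeff_binarySeries_eq_zero _ _ h0 (by simpa using h), zero_mul]

theorem binarySeries_mul_sub_one [CharP K 2] (x : K) :
    binarySeries k x * (binarySeries k x - 1) = PowerSeries.C x * PowerSeries.X +
      PowerSeries.C (x ^ 2 ^ (k + 1)) * PowerSeries.X ^ 2 ^ (k + 1) := by
  have : CharP (PowerSeries K) 2 := charP_of_injective_ringHom PowerSeries.C_injective 2
  have hsq : (∑ i ∈ Finset.range (k + 1),
      PowerSeries.C (x ^ 2 ^ i) * (PowerSeries.X : PowerSeries K) ^ 2 ^ i) ^ 2 =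
      ∑ i ∈ Finset.range (k + 1),
        PowerSeries.C (x ^ 2 ^ (i + 1)) * (PowerSeries.X : PowerSeries K) ^ 2 ^ (i + 1) := by
    rw [CharTwo.sum_sq]
    refine Finset.sum_congr rfl fun i _ => ?_
    rw [mul_pow, ← map_pow, ← pow_mul, ← pow_mul, pow_succ]
  rw [binarySeries, add_sub_cancel_left, add_mul, one_mul, ← sq, hsq, ← CharTwo.sub_eq_add,
    ← neg_sub, ← Finset.sum_sub_distrib,
    Finset.sum_range_sub
      (fun i => PowerSeries.C (x ^ 2 ^ i) * (PowerSeries.X : PowerSeries K) ^ 2 ^ i),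
    CharTwo.neg_eq, CharTwo.sub_eq_add, add_comm]
  simp

theorem sum_dicksonInvariant_mul_pow [CharP K 2] (v : Fin k → K) (j : Fin k) :
    ∑ i ∈ Finset.range (k + 1), dicksonInvariant v i * v j ^ 2 ^ i = 0 := by
  unfold dicksonInvariant
  rw [← coeff_mul_binarySeries_sub_one, dicksonSeries,
    ← Finset.prod_erase_mul _ _ (Finset.mem_univ j), mul_assoc, binarySeries_mul_sub_one, mul_add,
    map_add]
  have hlt : ¬ 2 ^ (k + 1) ≤ 2 ^ k := by
    rw [Nat.pow_le_pow_iff_right (by norm_num)]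
    omega
  rw [mul_left_comm, PowerSeries.coeff_C_mul, mul_left_comm, PowerSeries.coeff_C_mul,
    PowerSeries.coeff_mul_X_pow', if_neg hlt, mul_zero, add_zero,
    ← pow_one PowerSeries.X, PowerSeries.coeff_mul_X_pow', if_pos Nat.one_le_two_pow,
    coeff_prod_binarySeries_eq_zero, mul_zero]
  rw [digits_two_sum_two_pow_sub_one, Finset.card_erase_of_mem (Finset.mem_univ j),
    Finset.card_univ, Fintype.card_fin]
  have := j.pos
  omega

theorem dicksonInvariant_self (v : Fin k → K) : dicksonInvariant v k = 1 := by
  rw [dicksonInvariant, Nat.sub_self, PowerSeries.coeff_zero_eq_constantCoeff, dicksonSeries,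
    map_prod]
  refine Finset.prod_eq_one fun j _ => ?_
  rw [← PowerSeries.coeff_zero_eq_constantCoeff_apply, coeff_binarySeries _ _ (Nat.zero_le _)]
  simp

theorem msymm_sum_filter_eq {σ R : Type*} [Fintype σ] [DecidableEq σ] [CommSemiring R] (N : ℕ)
    (p : Nat.Partition N → Prop) [DecidablePred p] :
    ∑ μ ∈ Finset.univ.filter p, MvPolynomial.msymm σ R μ =
      ∑ s : Sym σ N, if p (.ofSym s) then (s.1.map MvPolynomial.X).prod else 0 := by
  rw [← Finset.sum_filter]
  have (μ : Nat.Partition N) : MvPolynomial.msymm σ R μ =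
      ∑ s ∈ Finset.univ.filter (fun s : Sym σ N => Nat.Partition.ofSym s = μ),
        (s.1.map MvPolynomial.X).prod := by
    rw [MvPolynomial.msymm]
    exact (Finset.sum_subtype _ (by simp)
      (fun s : Sym σ N => (s.1.map (MvPolynomial.X (R := R))).prod)).symm
  simp_rw [this]
  rw [Finset.sum_filter, ← Finset.sum_fiberwise _ (fun s : Sym σ N => Nat.Partition.ofSym s)]
  refine Finset.sum_congr rfl fun μ _ => ?_
  rw [Finset.filter_filter]
  split_ifs with h
  · refine Finset.sum_congr ?_ fun _ _ => rfl
    ext s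
    simp only [Finset.mem_filter, Finset.mem_univ, true_and]
    exact ⟨fun hs => ⟨hs ▸ h, hs⟩, And.right⟩
  · symm
    refine Finset.sum_eq_zero fun s hs => ?_
    simp only [Finset.mem_filter, Finset.mem_univ, true_and] at hs
    exact absurd (hs.2 ▸ hs.1) h

theorem aeval_Theta [Algebra (ZMod 2) K] (v : Fin k → K) :
    MvPolynomial.aeval v (Theta k) = PowerSeries.coeff (2 ^ (k - 1)) (dicksonSeries v) := by
  classical
  rw [Theta, msymm_sum_filter_eq, map_sum, dicksonSeries, PowerSeries.coeff_prod]
  refine Finset.sum_bij (fun s _ => Multiset.toFinsupp s.1) ?_ ?_ ?_ ?_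
  · intro s _
    simp only [Finset.mem_finsuppAntidiag, Finset.subset_univ, and_true]
    have := Multiset.toFinsupp_sum_eq s.1
    rw [Finsupp.sum_fintype _ _ (by simp)] at this
    exact this.trans s.2
  · intro s _ t _ h
    exact Subtype.ext (Multiset.toFinsupp.injective h)
  · intro l hl
    simp only [Finset.mem_finsuppAntidiag, Finset.subset_univ, and_true] at hl
    refine ⟨⟨Finsupp.toMultiset l, ?_⟩, Finset.mem_univ _, by simp⟩
    rw [Finsupp.card_toMultiset, Finsupp.sum_fintype _ _ (by simp)]
    exact hl
  · intro s _
    have hle (j : Fin k) : Multiset.count j s.1 ≤ 2 ^ k := by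
      refine (Multiset.count_le_card _ _).trans ?_
      rw [s.2]
      exact Nat.pow_le_pow_right (by norm_num) (by omega)
    simp only [Multiset.toFinsupp_apply]
    rw [Finset.prod_congr rfl fun j _ => coeff_binarySeries (v j) _ (hle j)]
    have hcard : (Nat.Partition.ofSym s).parts.card ≤ k := by
      simp only [Nat.Partition.ofSym, Multiset.card_map]
      have := Finset.card_le_univ s.1.toFinset
      simpa [Multiset.toFinset] using this
    have hiff : ((Nat.Partition.ofSym s).parts.card ≤ k ∧
        ∀ i ∈ (Nat.Partition.ofSym s).parts, ∃ j, i = 2 ^ j) ↔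
        ∀ j, Multiset.count j s.1 = 0 ∨ ∃ i, Multiset.count j s.1 = 2 ^ i := by
      rw [and_iff_right hcard]
      simp only [Nat.Partition.ofSym, Multiset.mem_map, Multiset.mem_dedup,
        forall_exists_index, and_imp, forall_apply_eq_imp_iff₂, Multiset.count_eq_zero,
        ← imp_iff_not_or]
    by_cases h : ∀ j, Multiset.count j s.1 = 0 ∨ ∃ i, Multiset.count j s.1 = 2 ^ i
    · rw [if_pos (hiff.2 h), Finset.prod_congr rfl fun j _ => if_pos (h j), map_multiset_prod,
        Multiset.map_map, Finset.prod_multiset_map_count]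
      simp only [Function.comp_apply, MvPolynomial.aeval_X]
      refine Finset.prod_subset (Finset.subset_univ _) fun j _ hj => ?_
      rw [Multiset.mem_toFinset, ← Multiset.count_eq_zero] at hj
      rw [hj, pow_zero]
    · rw [if_neg (mt hiff.1 h), map_zero]
      push Not at h
      obtain ⟨j, hj0, hj⟩ := h
      refine (Finset.prod_eq_zero (Finset.mem_univ j) (if_neg ?_)).symm
      push Not
      exact ⟨hj0, hj⟩

theorem aeval_Theta_eq_dicksonInvariant [Algebra (ZMod 2) K] (hk : 1 ≤ k) (v : Fin k → K) :
    MvPolynomial.aeval v (Theta k) = dicksonInvariant v (k - 1) := by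
  obtain ⟨m, rfl⟩ := Nat.exists_eq_add_of_le' hk
  rw [aeval_Theta, dicksonInvariant, Nat.add_sub_cancel,
    show 2 ^ (m + 1) - 2 ^ m = 2 ^ m by rw [pow_succ]; omega]

end

/-- The polynomial `∑_{i < N} c_i X^(2^i)`. -/
noncomputable def linearizedPoly {K : Type*} [Field K] (c : ℕ → K) (N : ℕ) : Polynomial K :=
  ∑ i ∈ Finset.range N, Polynomial.C (c i) * Polynomial.X ^ 2 ^ i

section

variable {K : Type*} [Field K] {k : ℕ}

theorem coeff_linearizedPoly (c : ℕ → K) (N i : ℕ) :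
    (linearizedPoly c N).coeff (2 ^ i) = if i < N then c i else 0 := by
  simp only [linearizedPoly, Polynomial.finsetSum_coeff, Polynomial.coeff_C_mul_X_pow,
    Nat.pow_right_inj one_lt_two]
  simp

theorem eval_linearizedPoly (c : ℕ → K) (N : ℕ) (x : K) :
    (linearizedPoly c N).eval x = ∑ i ∈ Finset.range N, c i * x ^ 2 ^ i := by
  simp [linearizedPoly, Polynomial.eval_finsetSum]

theorem degree_linearizedPoly_lt (c : ℕ → K) (N : ℕ) :
    (linearizedPoly c N).degree < (2 ^ N : ℕ) := by
  rw [linearizedPoly]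
  refine (Polynomial.degree_sum_le _ _).trans_lt ?_
  rw [Finset.sup_lt_iff (WithBot.bot_lt_coe _)]
  intro i hi
  refine (Polynomial.degree_C_mul_X_pow_le _ _).trans_lt ?_
  exact_mod_cast Nat.pow_lt_pow_right (by norm_num) (Finset.mem_range.1 hi)

theorem linearizedPoly_succ (c : ℕ → K) (N : ℕ) :
    linearizedPoly c (N + 1) =
      linearizedPoly c N + Polynomial.C (c N) * Polynomial.X ^ 2 ^ N := by
  simp [linearizedPoly, Finset.sum_range_succ]

theorem coeff_zero_prod_X_sub_C (s : Finset K) :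
    (∏ x ∈ s, (Polynomial.X - Polynomial.C x)).coeff 0 = ∏ x ∈ s, -x := by
  simp [Polynomial.coeff_zero_eq_eval_zero, Polynomial.eval_prod]

theorem coeff_one_prod_X_sub_C (s : Finset K) (hs : (0 : K) ∉ s) :
    (∏ x ∈ s, (Polynomial.X - Polynomial.C x)).coeff 1 = -((∏ x ∈ s, -x) * ∑ x ∈ s, x⁻¹) := by
  classical
  induction s using Finset.induction_on with
  | empty => simp [Polynomial.coeff_one]
  | insert a s ha ih =>
    have ha0 : a ≠ 0 := fun h => hs (by simp [h])
    rw [Finset.prod_insert ha, Finset.prod_insert ha, Finset.sum_insert ha, sub_mul,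
      Polynomial.coeff_sub, Polynomial.coeff_X_mul, Polynomial.coeff_C_mul,
      ih fun h => hs (Finset.mem_insert_of_mem h), coeff_zero_prod_X_sub_C]
    field_simp
    ring

variable [Algebra (ZMod 2) K]

theorem eval_linearizedPoly_eq_zero_of_mem_span (c : ℕ → K) (N : ℕ) (v : Fin k → K)
    (h : ∀ j, (linearizedPoly c N).eval (v j) = 0) {x : K}
    (hx : x ∈ Submodule.span (ZMod 2) (Set.range v)) :
    (linearizedPoly c N).eval x = 0 := by
  have : CharP K 2 := charP_of_injective_algebraMap (algebraMap (ZMod 2) K).injective 2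
  induction hx using Submodule.span_induction with
  | mem x hx => obtain ⟨j, rfl⟩ := hx; exact h j
  | zero => simp [eval_linearizedPoly]
  | add x y _ _ hx hy =>
    rw [eval_linearizedPoly] at *
    simp only [add_pow_char_pow, mul_add, Finset.sum_add_distrib, hx, hy, add_zero]
  | smul a x _ hx =>
    obtain rfl | rfl := (by decide : ∀ a : ZMod 2, a = 0 ∨ a = 1) a
    · simp [eval_linearizedPoly]
    · rwa [one_smul]

theorem mooreDet_aeval (e : Fin k → ℕ) (v : Fin k → K) :
    MvPolynomial.aeval v (Matrix.det (Matrix.of fun i j : Fin k =>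
      (MvPolynomial.X j : MvPolynomial (Fin k) (ZMod 2)) ^ 2 ^ e i)) =
    Matrix.det (Matrix.of fun i j : Fin k => v j ^ 2 ^ e i) := by
  rw [AlgHom.map_det]
  congr 1
  ext i j
  simp

variable [Finite K]

/-- The finite set of elements of the `F₂`-span of `v`. -/
noncomputable def spanFinset (v : Fin k → K) : Finset K :=
  (Set.toFinite (Submodule.span (ZMod 2) (Set.range v) : Set K)).toFinset

theorem mem_spanFinset {v : Fin k → K} {x : K} :
    x ∈ spanFinset v ↔ x ∈ Submodule.span (ZMod 2) (Set.range v) := by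
  simp [spanFinset]

theorem card_spanFinset {v : Fin k → K} (hv : LinearIndependent (ZMod 2) v) :
    (spanFinset v).card = 2 ^ k := by
  have h : Nat.card (Submodule.span (ZMod 2) (Set.range v)) = 2 ^ k := by
    rw [Module.natCard_eq_pow_finrank (K := ZMod 2), finrank_span_eq_card hv, Nat.card_zmod,
      Fintype.card_fin]
  rw [← h, spanFinset, ← Set.ncard_eq_toFinset_card, Set.ncard_def, Set.encard, ENat.card,
    Nat.card]
  rfl

theorem eq_zero_of_degree_lt_of_eval_span {v : Fin k → K} (hv : LinearIndependent (ZMod 2) v)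
    (p : Polynomial K) (hdeg : p.degree < (2 ^ k : ℕ)) (h : ∀ x ∈ spanFinset v, p.eval x = 0) :
    p = 0 := by
  refine Polynomial.eq_zero_of_degree_lt_of_eval_finset_eq_zero (spanFinset v) ?_ h
  rwa [card_spanFinset hv]

theorem prod_spanFinset_eq {v : Fin k → K} (hv : LinearIndependent (ZMod 2) v) :
    ∏ x ∈ spanFinset v, (Polynomial.X - Polynomial.C x) =
      linearizedPoly (dicksonInvariant v) (k + 1) := by
  have : CharP K 2 := charP_of_injective_algebraMap (algebraMap (ZMod 2) K).injective 2
  rw [← sub_eq_zero]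
  refine eq_zero_of_degree_lt_of_eval_span hv _ ?_ fun x hx => ?_
  · rw [linearizedPoly_succ, dicksonInvariant_self, map_one, one_mul, add_comm, ← sub_sub]
    have hmon : (∏ x ∈ spanFinset v, (Polynomial.X - Polynomial.C x)).Monic :=
      Polynomial.monic_prod_X_sub_C _ _
    have hd : (∏ x ∈ spanFinset v, (Polynomial.X - Polynomial.C x)).degree =
        ((2 ^ k : ℕ) : WithBot ℕ) := by
      rw [Polynomial.degree_eq_natDegree hmon.ne_zero,
        Polynomial.natDegree_finsetProd_X_sub_C_eq_card,
        card_spanFinset hv]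
    refine (Polynomial.degree_sub_le _ _).trans_lt (max_lt ?_ (degree_linearizedPoly_lt _ _))
    rw [← hd]
    refine Polynomial.degree_sub_lt_left ?_ hmon.ne_zero ?_
    · rw [hd, Polynomial.degree_X_pow]
    · rw [hmon, Polynomial.leadingCoeff_X_pow]
  · rw [Polynomial.eval_sub, eval_linearizedPoly_eq_zero_of_mem_span _ _ v _ (mem_spanFinset.1 hx),
      Polynomial.eval_prod, Finset.prod_eq_zero hx (by simp), sub_zero]
    intro j
    rw [eval_linearizedPoly, sum_dicksonInvariant_mul_pow]

theorem prod_spanFinset_eq_X_mul (v : Fin k → K) :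
    ∏ x ∈ spanFinset v, (Polynomial.X - Polynomial.C x) =
      Polynomial.X * open scoped Classical in
        ∏ x ∈ (spanFinset v).erase 0, (Polynomial.X - Polynomial.C x) := by
  classical
  rw [← Finset.mul_prod_erase _ _ (mem_spanFinset.2 (zero_mem _)), map_zero, sub_zero]

theorem dicksonInvariant_zero_ne_zero {v : Fin k → K} (hv : LinearIndependent (ZMod 2) v) :
    dicksonInvariant v 0 ≠ 0 := by
  classical
  have h := coeff_linearizedPoly (dicksonInvariant v) (k + 1) 0
  rw [if_pos (Nat.succ_pos k), ← prod_spanFinset_eq hv, prod_spanFinset_eq_X_mul, pow_zero,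
    show (1 : ℕ) = 0 + 1 from rfl, Polynomial.coeff_X_mul, coeff_zero_prod_X_sub_C] at h
  rw [← h, Finset.prod_ne_zero_iff]
  intro x hx
  exact neg_ne_zero.2 (Finset.ne_of_mem_erase hx)

theorem dicksonInvariant_one_eq_zero_iff (hk : 1 ≤ k) {v : Fin k → K}
    (hv : LinearIndependent (ZMod 2) v) :
    dicksonInvariant v 1 = 0 ↔
      ∑ᶠ x ∈ {x : K | x ∈ Submodule.span (ZMod 2) (Set.range v) ∧ x ≠ 0}, x⁻¹ = 0 := by
  classical
  have h := coeff_linearizedPoly (dicksonInvariant v) (k + 1) 1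
  rw [if_pos (by omega), ← prod_spanFinset_eq hv, prod_spanFinset_eq_X_mul, pow_one,
    Polynomial.coeff_X_mul, coeff_one_prod_X_sub_C _ (by simp)] at h
  have hset : {x : K | x ∈ Submodule.span (ZMod 2) (Set.range v) ∧ x ≠ 0} =
      ((spanFinset v).erase 0 : Finset K) := by
    ext x
    simp [mem_spanFinset, and_comm]
  have hne : ∏ x ∈ (spanFinset v).erase 0, -x ≠ 0 :=
    Finset.prod_ne_zero_iff.2 fun x hx => neg_ne_zero.2 (Finset.ne_of_mem_erase hx)
  rw [← h, neg_eq_zero, mul_eq_zero, or_iff_right hne, hset, finsum_mem_coe_finset]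

theorem moore_det_ne_zero {v : Fin k → K} (hv : LinearIndependent (ZMod 2) v) :
    Matrix.det (Matrix.of fun i j : Fin k => v j ^ 2 ^ (i : ℕ)) ≠ 0 := by
  intro h
  obtain ⟨c, hc, hcM⟩ := Matrix.exists_vecMul_eq_zero_iff.2 h
  set c' : ℕ → K := fun i => if h : i < k then c ⟨i, h⟩ else 0 with hc'
  have hp : linearizedPoly c' k = 0 := by
    refine eq_zero_of_degree_lt_of_eval_span hv _ (degree_linearizedPoly_lt _ _) fun x hx =>
      eval_linearizedPoly_eq_zero_of_mem_span _ _ v (fun j => ?_) (mem_spanFinset.1 hx)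
    rw [eval_linearizedPoly, Finset.sum_range]
    simpa [hc', Matrix.vecMul, dotProduct] using congrFun hcM j
  apply hc
  ext i
  have := coeff_linearizedPoly c' k i
  rw [hp, if_pos i.2] at this
  simpa [hc'] using this.symm

theorem moore_det_one_eq_zero_iff (hk : 1 ≤ k) {v : Fin k → K}
    (hv : LinearIndependent (ZMod 2) v) :
    Matrix.det (Matrix.of fun i j : Fin k =>
      v j ^ 2 ^ (if (i : ℕ) = 0 then 0 else (i : ℕ) + 1)) = 0 ↔ dicksonInvariant v 1 = 0 := by
  have : CharP K 2 := charP_of_injective_algebraMap (algebraMap (ZMod 2) K).injective 2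
  obtain ⟨m, rfl⟩ := Nat.exists_eq_add_of_le' hk
  rw [← Matrix.exists_vecMul_eq_zero_iff]
  constructor
  · rintro ⟨c, hc, hcM⟩
    let c' : ℕ → K := fun i => match i with
      | 0 => c 0
      | 1 => 0
      | i + 2 => if h : i < m then c (Fin.succ ⟨i, h⟩) else 0
    have hc2 (i : Fin m) : c' (i + 1 + 1) = c i.succ := by simp [c', Fin.succ]
    have hc1 : c' (0 + 1) = 0 := rfl
    have hc0 : c' 0 = c 0 := rfl
    clear_value c'
    set p := linearizedPoly c' (m + 2) -
      Polynomial.C (c' (m + 1)) * linearizedPoly (dicksonInvariant v) (m + 2) with hp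
    have hp0 : p = 0 := by
      refine eq_zero_of_degree_lt_of_eval_span hv _ ?_ fun x hx => ?_
      · have : p = linearizedPoly c' (m + 1) -
            Polynomial.C (c' (m + 1)) * linearizedPoly (dicksonInvariant v) (m + 1) := by
          rw [hp, linearizedPoly_succ c', linearizedPoly_succ (dicksonInvariant v),
            dicksonInvariant_self, map_one]
          ring
        rw [this, ← Polynomial.smul_eq_C_mul]
        exact (Polynomial.degree_sub_le _ _).trans_lt (max_lt (degree_linearizedPoly_lt _ _)
          ((Polynomial.degree_smul_le _ _).trans_lt (degree_linearizedPoly_lt _ _)))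
      · rw [mem_spanFinset] at hx
        rw [Polynomial.eval_sub, Polynomial.eval_mul,
          eval_linearizedPoly_eq_zero_of_mem_span _ _ v (fun j => ?_) hx,
          eval_linearizedPoly_eq_zero_of_mem_span _ _ v (fun j => ?_) hx, mul_zero, sub_zero]
        · rw [eval_linearizedPoly, sum_dicksonInvariant_mul_pow]
        · rw [eval_linearizedPoly, Finset.sum_range_succ', Finset.sum_range_succ',
            Finset.sum_range]
          have := congrFun hcM j
          simp only [Matrix.vecMul, dotProduct, Fin.sum_univ_succ] at this
          simp only [hc2, hc1, hc0, zero_mul, add_zero]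
          rw [add_comm]
          simpa using this
    have hcoef (i : ℕ) (hi : i < m + 2) : c' i = c' (m + 1) * dicksonInvariant v i := by
      have := congrArg (fun q => q.coeff (2 ^ i)) hp0
      simpa [hp, coeff_linearizedPoly, hi, sub_eq_zero] using this
    by_cases htop : c' (m + 1) = 0
    · refine absurd ?_ hc
      have h0 (i : ℕ) (hi : i < m + 2) : c' i = 0 := by rw [hcoef i hi, htop, zero_mul]
      ext i
      refine Fin.cases ?_ (fun i => ?_) i
      · exact hc0.symm.trans (h0 0 (by omega))
      · exact (hc2 i).symm.trans (h0 (i + 2) (by omega))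
    · have := hcoef 1 (by omega)
      exact (mul_eq_zero.1 (this.symm.trans hc1)).resolve_left htop
  · intro h1
    refine ⟨fun i => dicksonInvariant v (if (i : ℕ) = 0 then 0 else (i : ℕ) + 1), ?_, ?_⟩
    · intro h
      have := congrFun h 0
      simp only [Fin.val_zero, if_true, Pi.zero_apply] at this
      exact dicksonInvariant_zero_ne_zero hv this
    · ext j
      have := sum_dicksonInvariant_mul_pow v j
      rw [Finset.sum_range_succ', Finset.sum_range_succ', Finset.sum_range] at this
      simp only [Matrix.vecMul, dotProduct, Fin.sum_univ_succ]
      simpa [h1, add_comm] using this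

theorem aeval_eq_zero_iff (hk : 1 ≤ k) {G : MvPolynomial (Fin k) (ZMod 2)}
    (hG : MooreDet k * G = MooreDet1 k) {v : Fin k → K} (hv : LinearIndependent (ZMod 2) v) :
    MvPolynomial.aeval v G = 0 ↔ dicksonInvariant v 1 = 0 := by
  have h := congrArg (MvPolynomial.aeval v) hG
  rw [map_mul, MooreDet, MooreDet1, mooreDet_aeval, mooreDet_aeval] at h
  rw [← moore_det_one_eq_zero_iff hk hv, ← h, mul_eq_zero, or_iff_right (moore_det_ne_zero hv)]

end

/-- `u` is dual to `v` if it is the last column of the inverse Moore matrix of `v`. -/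
def IsMooreDual {K : Type*} [Field K] {k : ℕ} (u v : Fin k → K) : Prop :=
  ∀ b < k, ∑ j, u j * v j ^ 2 ^ b = if b + 1 = k then 1 else 0

section

variable {K : Type*} [Field K] [Algebra (ZMod 2) K] {k : ℕ} {u v : Fin k → K}

theorem IsMooreDual.sum_pow_mul_pow (h : IsMooreDual u v) (a b : ℕ) (hab : a ≤ b)
    (hba : b < a + k) :
    ∑ j, u j ^ 2 ^ a * v j ^ 2 ^ b = if b + 1 = a + k then 1 else 0 := by
  have : CharP K 2 := charP_of_injective_algebraMap (algebraMap (ZMod 2) K).injective 2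
  obtain ⟨d, rfl⟩ := Nat.exists_eq_add_of_le hab
  have hd := congrArg (· ^ 2 ^ a) (h d (by omega))
  simp only [sum_pow_char_pow, mul_pow, ← pow_mul, ← pow_add] at hd
  rw [add_comm a d, hd]
  by_cases h1 : d + 1 = k
  · rw [if_pos h1, if_pos (by omega), one_pow]
  · rw [if_neg h1, if_neg (by omega), zero_pow (by positivity)]

theorem IsMooreDual.det_ne_zero (h : IsMooreDual u v) :
    Matrix.det (Matrix.of fun i j : Fin k => u j ^ 2 ^ (i : ℕ)) ≠ 0 := by
  have hmul : (Matrix.of fun i j : Fin k => u j ^ 2 ^ (i : ℕ)) *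
      (Matrix.of fun j b : Fin k => v j ^ 2 ^ (k - 1 + b)) =
      Matrix.of fun i b : Fin k => ∑ j, u j ^ 2 ^ (i : ℕ) * v j ^ 2 ^ (k - 1 + b) := by
    ext i b
    simp [Matrix.mul_apply]
  have hdet := congrArg Matrix.det hmul
  rw [Matrix.det_mul, Matrix.det_of_isUpperTriangular (M := Matrix.of fun i b : Fin k =>
    ∑ j, u j ^ 2 ^ (i : ℕ) * v j ^ 2 ^ (k - 1 + b)), Finset.prod_eq_one] at hdet
  · exact left_ne_zero_of_mul_eq_one hdet
  · intro i _
    rw [Matrix.of_apply, h.sum_pow_mul_pow _ _ (by omega) (by omega), if_pos (by omega)]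
  · intro i b hb
    have hb' : (b : ℕ) < i := hb
    rw [Matrix.of_apply, h.sum_pow_mul_pow _ _ (by omega) (by omega), if_neg (by omega)]

theorem IsMooreDual.linearIndependent (h : IsMooreDual u v) :
    LinearIndependent (ZMod 2) u := by
  have : CharP K 2 := charP_of_injective_algebraMap (algebraMap (ZMod 2) K).injective 2
  rw [Fintype.linearIndependent_iff]
  intro g hg i
  have h0 : (fun j => algebraMap (ZMod 2) K (g j)) = 0 := by
    refine Matrix.eq_zero_of_mulVec_eq_zero h.det_ne_zero ?_
    ext a
    have := congrArg (· ^ 2 ^ (a : ℕ)) hg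
    simp only [sum_pow_char_pow, Algebra.smul_def, mul_pow, ← map_pow, ZMod.pow_card_pow] at this
    rw [zero_pow (by positivity)] at this
    simpa [Matrix.mulVec, dotProduct, mul_comm] using this
  exact (algebraMap (ZMod 2) K).injective ((congrFun h0 i).trans (map_zero _).symm)

theorem IsMooreDual.right_unique {v' : Fin k → K} (h : IsMooreDual u v)
    (h' : IsMooreDual u v') : v = v' := by
  have : CharP K 2 := charP_of_injective_algebraMap (algebraMap (ZMod 2) K).injective 2
  have h0 : (fun j => v j ^ 2 ^ (k - 1) - v' j ^ 2 ^ (k - 1)) = 0 := by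
    refine Matrix.eq_zero_of_mulVec_eq_zero h.det_ne_zero ?_
    ext a
    simp only [Matrix.mulVec, dotProduct, Matrix.of_apply, mul_sub, Finset.sum_sub_distrib,
      Pi.zero_apply]
    rw [h.sum_pow_mul_pow _ _ (by omega) (by omega), h'.sum_pow_mul_pow _ _ (by omega) (by omega),
      sub_self]
  ext j
  have hj := congrFun h0 j
  simp only [← sub_pow_char_pow, Pi.zero_apply] at hj
  exact sub_eq_zero.1 (eq_zero_of_pow_eq_zero hj)

theorem IsMooreDual.dicksonInvariant_eq_zero_iff [Finite K] (h : IsMooreDual u v) (hk : 1 ≤ k) :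
    dicksonInvariant u 1 = 0 ↔ dicksonInvariant v (k - 1) = 0 := by
  have : CharP K 2 := charP_of_injective_algebraMap (algebraMap (ZMod 2) K).injective 2
  set s := ∑ j, u j * v j ^ 2 ^ k with hs
  have hv : dicksonInvariant v (k - 1) + s = 0 := by
    have : ∑ i ∈ Finset.range (k + 1), dicksonInvariant v i * ∑ j, u j * v j ^ 2 ^ i = 0 := by
      simp only [Finset.mul_sum]
      rw [Finset.sum_comm]
      refine Finset.sum_eq_zero fun j _ => ?_
      simp only [mul_left_comm _ (u j), ← Finset.mul_sum, sum_dicksonInvariant_mul_pow, mul_zero]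
    rw [Finset.sum_range_succ, dicksonInvariant_self, one_mul,
      Finset.sum_eq_single_of_mem (k - 1) (Finset.mem_range.2 (by omega)), h _ (by omega),
      if_pos (by omega), mul_one] at this
    · exact this
    · intro i hi hik
      rw [Finset.mem_range] at hi
      rw [h i hi, if_neg (by omega), mul_zero]
  have hu : dicksonInvariant u 1 + dicksonInvariant u 0 * s = 0 := by
    have : ∑ i ∈ Finset.range (k + 1),
        dicksonInvariant u i * ∑ j, u j ^ 2 ^ i * v j ^ 2 ^ k = 0 := by
      simp only [Finset.mul_sum]
      rw [Finset.sum_comm]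
      refine Finset.sum_eq_zero fun j _ => ?_
      simp only [← mul_assoc, ← Finset.sum_mul, sum_dicksonInvariant_mul_pow, zero_mul]
    rw [Finset.sum_range_succ', Finset.sum_eq_single_of_mem 0 (Finset.mem_range.2 (by omega)),
      h.sum_pow_mul_pow _ _ (by omega) (by omega), if_pos (by omega), mul_one] at this
    · simpa using this
    · intro i hi hi0
      rw [Finset.mem_range] at hi
      rw [h.sum_pow_mul_pow _ _ (by omega) (by omega), if_neg (by omega), mul_zero]
  have h0 := dicksonInvariant_zero_ne_zero h.linearIndependent
  have hu' : dicksonInvariant u 1 = 0 ↔ s = 0 := by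
    rw [eq_neg_of_add_eq_zero_left hu, neg_eq_zero, mul_eq_zero, or_iff_right h0]
  rw [hu', eq_neg_of_add_eq_zero_left hv, neg_eq_zero]

theorem exists_isMooreDual [Finite K] (hv : LinearIndependent (ZMod 2) v) :
    ∃ u, IsMooreDual u v := by
  have hu := (Matrix.isUnit_iff_isUnit_det _).2 (moore_det_ne_zero hv).isUnit
  obtain ⟨u, hu⟩ := (Matrix.mulVec_surjective_iff_isUnit.2 hu)
    fun b => if (b : ℕ) + 1 = k then 1 else 0
  refine ⟨u, fun b hb => ?_⟩
  simpa [Matrix.mulVec, dotProduct, mul_comm] using congrFun hu ⟨b, hb⟩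

theorem ncard_Theta_eq_ncard_dicksonInvariant_one (K : Type*) [Field K] [Algebra (ZMod 2) K]
    [Finite K] {k : ℕ} (hk : 1 ≤ k) :
    {v : Fin k → K | LinearIndependent (ZMod 2) v ∧ MvPolynomial.aeval v (Theta k) = 0}.ncard =
      {u : Fin k → K | LinearIndependent (ZMod 2) u ∧ dicksonInvariant u 1 = 0}.ncard := by
  choose d hd using fun v : {v : Fin k → K // LinearIndependent (ZMod 2) v} =>
    exists_isMooreDual v.2
  let D (v : {v : Fin k → K // LinearIndependent (ZMod 2) v}) :
    {v : Fin k → K // LinearIndependent (ZMod 2) v} := ⟨d v, (hd v).linearIndependent⟩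
  have hDinj : Function.Injective D := fun v w hvw => by
    have hdd : d v = d w := congrArg Subtype.val hvw
    have hw := hd w
    rw [← hdd] at hw
    exact Subtype.ext ((hd v).right_unique hw)
  have hDsurj := Finite.surjective_of_injective hDinj
  refine Set.ncard_congr (fun v hv => d ⟨v, hv.1⟩) ?_ ?_ ?_
  · rintro v ⟨hv, hT⟩
    rw [aeval_Theta_eq_dicksonInvariant hk] at hT
    exact ⟨(hd ⟨v, hv⟩).linearIndependent, ((hd ⟨v, hv⟩).dicksonInvariant_eq_zero_iff hk).2 hT⟩
  · intro v w hv hw h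
    exact congrArg Subtype.val (@hDinj ⟨v, hv.1⟩ ⟨w, hw.1⟩ (Subtype.ext h))
  · rintro u ⟨hu, h1⟩
    obtain ⟨v, hv⟩ := hDsurj ⟨u, hu⟩
    have hvu : d v = u := congrArg Subtype.val hv
    refine ⟨v, ⟨v.2, ?_⟩, hvu⟩
    rw [aeval_Theta_eq_dicksonInvariant hk, ← (hd v).dicksonInvariant_eq_zero_iff hk, hvu]
    exact h1

end

theorem ncard_linearIndependent_span_eq_mul {F V : Type*} [Field F] [Finite F] [AddCommGroup V]
    [Module F V] [Finite V] (k : ℕ) (P : Submodule F V → Prop) :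
    {u : Fin k → V | LinearIndependent F u ∧ P (Submodule.span F (Set.range u))}.ncard =
      {E : Submodule F V | Module.finrank F E = k ∧ P E}.ncard *
        Nat.card (Matrix.GeneralLinearGroup (Fin k) F) := by
  classical
  have := Fintype.ofFinite F
  have : Finite (Submodule F V) := Finite.of_injective _ SetLike.coe_injective
  have := Fintype.ofFinite {E : Submodule F V | Module.finrank F E = k ∧ P E}
  let f (u : {u : Fin k → V | LinearIndependent F u ∧ P (Submodule.span F (Set.range u))}) :
      {E : Submodule F V | Module.finrank F E = k ∧ P E} :=
    ⟨Submodule.span F (Set.range u.1), by rw [finrank_span_eq_card u.2.1, Fintype.card_fin], u.2.2⟩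
  have hfib (E : {E : Submodule F V | Module.finrank F E = k ∧ P E}) :
      Nat.card {u // f u = E} = Nat.card (Matrix.GeneralLinearGroup (Fin k) F) := by
    have hE : Module.finrank F E.1 = k := E.2.1
    have hcard := card_linearIndependent (K := F) (V := E.1) hE.ge
    rw [hE] at hcard
    rw [Matrix.card_GL_field, ← hcard]
    have hli (s : {s : Fin k → E.1 // LinearIndependent F s}) :
        LinearIndependent F (fun i => (s.1 i : V)) :=
      s.2.map' E.1.subtype (Submodule.ker_subtype _)
    have hspan (s : {s : Fin k → E.1 // LinearIndependent F s}) :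
        Submodule.span F (Set.range fun i => (s.1 i : V)) = E.1 := by
      refine Submodule.eq_of_le_of_finrank_eq (Submodule.span_le.2 ?_) ?_
      · rintro _ ⟨i, rfl⟩
        exact (s.1 i).2
      · rw [finrank_span_eq_card (hli s), Fintype.card_fin, hE]
    symm
    refine Nat.card_eq_of_bijective (fun s => ⟨⟨fun i => (s.1 i : V), hli s, ?_⟩, ?_⟩) ⟨?_, ?_⟩
    · rw [hspan s]
      exact E.2.2
    · exact Subtype.ext (hspan s)
    · intro s t h
      have h' := congrArg (fun x => x.1.1) h
      exact Subtype.ext (funext fun i => Subtype.ext (congrFun h' i))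
    · rintro ⟨⟨u, hu⟩, hf⟩
      have hf' : Submodule.span F (Set.range u) = E.1 := congrArg Subtype.val hf
      have hmem (i : Fin k) : u i ∈ E.1 := hf' ▸ Submodule.subset_span ⟨i, rfl⟩
      exact ⟨⟨fun i => ⟨u i, hmem i⟩, LinearIndependent.of_comp E.1.subtype hu.1⟩, rfl⟩
  rw [← Nat.card_coe_set_eq, ← Nat.card_congr (Equiv.sigmaFiberEquiv f), Nat.card_sigma]
  simp only [hfib, Finset.sum_const, Finset.card_univ, smul_eq_mul]
  rw [← Nat.card_eq_fintype_card, Nat.card_coe_set_eq]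

/-- Let `1 ≤ k ≤ n`, let `Z_k` be the number of `k`-dimensional zero-sum subspaces of
`F_{2^n}`, and let `G = F_k`, i.e. `Δ·G = Δ₁`.  Then the number of `F₂`-linearly
independent `k`-tuples `(u_1,…,u_k)` with `F_k(u_1,…,u_k) = 0` equals
`Z_k·|GL(k,F₂)|`, and the number of `F₂`-linearly independent `k`-tuples
`(v_1,…,v_k)` with `Θ_k(v_1,…,v_k) = 0` also equals `Z_k·|GL(k,F₂)|`. -/
theorem count_tuples_eq_zero_sum_count (n k : ℕ) (hk : 1 ≤ k) (hkn : k ≤ n)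
    (G : MvPolynomial (Fin k) (ZMod 2))
    (hG : MooreDet k * G = MooreDet1 k) :
    {u : Fin k → GaloisField 2 n |
        LinearIndependent (ZMod 2) u ∧ MvPolynomial.aeval u G = 0}.ncard =
      {E : Submodule (ZMod 2) (GaloisField 2 n) |
          Module.finrank (ZMod 2) E = k ∧
          ∑ᶠ x ∈ {x : GaloisField 2 n | x ∈ E ∧ x ≠ 0}, x⁻¹ = 0}.ncard *
        Nat.card (Matrix.GeneralLinearGroup (Fin k) (ZMod 2)) ∧
    {v : Fin k → GaloisField 2 n |
        LinearIndependent (ZMod 2) v ∧ MvPolynomial.aeval v (Theta k) = 0}.ncard =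
      {E : Submodule (ZMod 2) (GaloisField 2 n) |
          Module.finrank (ZMod 2) E = k ∧
          ∑ᶠ x ∈ {x : GaloisField 2 n | x ∈ E ∧ x ≠ 0}, x⁻¹ = 0}.ncard *
        Nat.card (Matrix.GeneralLinearGroup (Fin k) (ZMod 2)) := by
  have hZ := ncard_linearIndependent_span_eq_mul (F := ZMod 2) k
    fun E : Submodule (ZMod 2) (GaloisField 2 n) =>
      ∑ᶠ x ∈ {x : GaloisField 2 n | x ∈ E ∧ x ≠ 0}, x⁻¹ = 0
  rw [ncard_Theta_eq_ncard_dicksonInvariant_one _ hk, ← hZ]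
  refine ⟨congrArg Set.ncard (Set.ext fun u => and_congr_right fun hu => ?_),
    congrArg Set.ncard (Set.ext fun u => and_congr_right fun hu => ?_)⟩
  · rw [aeval_eq_zero_iff hk hG hu, dicksonInvariant_one_eq_zero_iff hk hu]
  · exact dicksonInvariant_one_eq_zero_iff hk hu
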